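/- arXiv:2303.10633 — 9 statements merged into one kernel-verified Lean document; each statement's English description precedes it below -/
import Mathlib

section
/- Let N and n_x be positive integers and let A_i ∈ ℝ^{n_x×n_x} for i = 1,…,N. The following are equivalent: (a) there exist symmetric positive definite matrices S̄_i ∈ ℝ^{n_x×n_x} and matrices X_i ∈ ℝ^{n_x×n_x} (i = 1,…,N) such that the 2×2 block matrix [[X_i + X_iᵀ − S̄_i, X_iᵀA_iᵀ],[A_iX_i, S̄_j]] is positive definite for all i, j ∈ {1,…,N}; (b) there exist symmetric positive definite matrices S̄_i ∈ ℝ^{n_x×n_x} (i = 1,…,N) such that the 2×2 block matrix [[S̄_i, S̄_iA_iᵀ],[A_iS̄_i, S̄_j]] is positive definite for all i, j ∈ {1,…,N}. -/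
open Matrix

namespace Matrix

variable {m n : Type*} [Fintype m] [Fintype n] [DecidableEq m]

/-- Completing the square: if `S` is positive definite, the block `X + Xᵀ - S` of a positive
definite matrix may be replaced by `Xᵀ * S⁻¹ * X`. -/
theorem PosDef.fromBlocks_transpose_mul_inv_mul {S X : Matrix m m ℝ} {B : Matrix m n ℝ}
    {C : Matrix n m ℝ} {D : Matrix n n ℝ} (hS : S.PosDef)
    (h : (fromBlocks (X + Xᵀ - S) B C D).PosDef) :
    (fromBlocks (Xᵀ * S⁻¹ * X) B C D).PosDef := by
  have hdet : IsUnit S.det := (isUnit_iff_isUnit_det S).1 hS.isUnit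
  have hSt : Sᵀ = S := by simpa using hS.isHermitian.eq
  have hsq := hS.inv.posSemidef.conjTranspose_mul_mul_same
    (fromCols (X - S) (0 : Matrix m n ℝ))
  convert h.add_posSemidef hsq using 1
  rw [conjTranspose_eq_transpose_of_trivial, transpose_fromCols, fromRows_mul,
    fromRows_mul_fromCols, fromBlocks_add]
  congr 1
  · rw [transpose_sub, hSt, Matrix.sub_mul, Matrix.sub_mul, Matrix.mul_sub, Matrix.mul_sub,
      mul_nonsing_inv _ hdet, nonsing_inv_mul_cancel_right _ _ hdet, Matrix.one_mul,
      Matrix.one_mul]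
    abel
  all_goals simp

/-- The slack-variable block inequality for a single pair `(S, D)` implies the slack-free one. -/
theorem PosDef.fromBlocks_of_slack [DecidableEq n] {S X : Matrix m m ℝ} {A : Matrix n m ℝ}
    {D : Matrix n n ℝ} (hS : S.PosDef)
    (h : (fromBlocks (X + Xᵀ - S) (Xᵀ * Aᵀ) (A * X) D).PosDef) :
    (fromBlocks S (S * Aᵀ) (A * S) D).PosDef := by
  have hSdet : IsUnit S.det := (isUnit_iff_isUnit_det S).1 hS.isUnit
  have hSt : Sᵀ = S := by simpa using hS.isHermitian.eq
  have hM := hS.fromBlocks_transpose_mul_inv_mul h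
  have hX : IsUnit X := by
    have h₁₁ : (Xᵀ * S⁻¹ * X).PosDef := hM.submatrix Sum.inl_injective
    have hu := (isUnit_iff_isUnit_det _).1 h₁₁.isUnit
    rw [det_mul] at hu
    exact (isUnit_iff_isUnit_det _).2 (isUnit_of_mul_isUnit_right hu)
  have hXdet : IsUnit X.det := (isUnit_iff_isUnit_det X).1 hX
  have hXtdet : IsUnit Xᵀ.det := by rwa [det_transpose]
  have hT : IsUnit (fromBlocks (X⁻¹ * S) 0 0 (1 : Matrix n n ℝ)) := by
    rw [isUnit_fromBlocks_zero₁₂]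
    exact ⟨((isUnit_nonsing_inv_iff).2 hX).mul hS.isUnit, isUnit_one⟩
  convert (IsUnit.posDef_star_left_conjugate_iff hT).2 hM using 1
  rw [star_eq_conjTranspose, conjTranspose_eq_transpose_of_trivial, fromBlocks_transpose,
    fromBlocks_multiply, fromBlocks_multiply]
  simp only [transpose_mul, hSt, transpose_nonsing_inv, transpose_zero, transpose_one,
    Matrix.zero_mul, Matrix.mul_zero, Matrix.one_mul, Matrix.mul_one, add_zero, zero_add]
  congr 1
  · simp only [Matrix.mul_assoc, mul_nonsing_inv_cancel_left _ _ hXdet,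
      nonsing_inv_mul_cancel_left _ _ hXtdet, nonsing_inv_mul _ hSdet, Matrix.mul_one]
  · simp only [Matrix.mul_assoc, nonsing_inv_mul_cancel_left _ _ hXtdet]
  · simp only [Matrix.mul_assoc, mul_nonsing_inv_cancel_left _ _ hXdet]

end Matrix

/-- Lemma 1 (L1.2 ⇔ L1.4): equivalence of the slack-variable LMI condition and the
slack-free LMI condition for poly-quadratic stability. -/
theorem lmi_slack_iff_slack_free (N nx : ℕ) (hN : 0 < N) (hnx : 0 < nx)
    (A : Fin N → Matrix (Fin nx) (Fin nx) ℝ) :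
    (∃ (S : Fin N → Matrix (Fin nx) (Fin nx) ℝ)
       (X : Fin N → Matrix (Fin nx) (Fin nx) ℝ),
      (∀ i, (S i).PosDef) ∧
      ∀ i j, (fromBlocks (X i + (X i)ᵀ - S i) ((X i)ᵀ * (A i)ᵀ)
                (A i * X i) (S j)).PosDef) ↔
    (∃ S : Fin N → Matrix (Fin nx) (Fin nx) ℝ,
      (∀ i, (S i).PosDef) ∧
      ∀ i j, (fromBlocks (S i) (S i * (A i)ᵀ) (A i * S i) (S j)).PosDef) := by
  constructor
  · rintro ⟨S, X, hS, h⟩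
    exact ⟨S, hS, fun i j => (hS i).fromBlocks_of_slack (h i j)⟩
  · rintro ⟨S, hS, h⟩
    refine ⟨S, S, hS, fun i j => ?_⟩
    have hSt : (S i)ᵀ = S i := by simpa using (hS i).isHermitian.eq
    rw [hSt, add_sub_cancel_right]
    exact h i j
end

section
/- Suppose there exist symmetric positive definite matrices S̄_i ∈ ℝ^{n_x×n_x} and matrices X_i ∈ ℝ^{n_x×n_x} (i = 1,…,N) such that the 2×2 block matrix [[X_i + X_iᵀ − S̄_i, X_iᵀA_iᵀ],[A_iX_i, S̄_j]] is positive definite for all i, j ∈ {1,…,N}. Then, with P̄_i := S̄_i⁻¹, the function V(π,x) = xᵀP(π)x is a poly-quadratic Lyapunov function for x_{k+1} = A(p_k)x_k; in particular, the polytopic system is poly-quadratically stable. -/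
open Matrix

theorem isCompact_dotProduct_self_eq_one {n : Type*} [Fintype n] :
    IsCompact {x : n → ℝ | x ⬝ᵥ x = 1} := by
  refine (isCompact_univ_pi fun _ : n => isCompact_Icc (a := (-1 : ℝ)) (b := 1)).of_isClosed_subset
    (isClosed_eq (by unfold dotProduct; fun_prop) continuous_const) fun x hx i _ => ?_
  have hi : x i * x i ≤ 1 := by
    rw [← show x ⬝ᵥ x = 1 from hx]
    exact Finset.single_le_sum (f := fun j => x j * x j) (fun j _ => mul_self_nonneg _)
      (Finset.mem_univ i)
  exact ⟨by nlinarith, by nlinarith⟩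

theorem continuous_dotProduct_mulVec_self {n : Type*} [Fintype n] (M : Matrix n n ℝ) :
    Continuous fun x : n → ℝ => x ⬝ᵥ (M *ᵥ x) := by
  unfold mulVec dotProduct
  fun_prop

/-- By homogeneity, a vector `x ≠ 0` has a multiple `y` of unit Euclidean length along which any
quadratic form scales like `x ⬝ᵥ x`. -/
theorem exists_unit_dotProduct_mulVec_self {n : Type*} [Fintype n] (M : Matrix n n ℝ)
    {x : n → ℝ} (hx : x ≠ 0) :
    0 < x ⬝ᵥ x ∧ ∃ y : n → ℝ, y ⬝ᵥ y = 1 ∧ x ⬝ᵥ (M *ᵥ x) = y ⬝ᵥ (M *ᵥ y) * (x ⬝ᵥ x) := by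
  have hpos : 0 < x ⬝ᵥ x := by simpa using dotProduct_self_star_pos_iff.2 hx
  have hs : (√(x ⬝ᵥ x))⁻¹ * (√(x ⬝ᵥ x))⁻¹ = (x ⬝ᵥ x)⁻¹ := by
    rw [← mul_inv, Real.mul_self_sqrt hpos.le]
  refine ⟨hpos, (√(x ⬝ᵥ x))⁻¹ • x, ?_, ?_⟩
  · simp only [smul_dotProduct, dotProduct_smul, smul_eq_mul, ← mul_assoc, hs]
    exact inv_mul_cancel₀ hpos.ne'
  · simp only [mulVec_smul, smul_dotProduct, dotProduct_smul, smul_eq_mul, ← mul_assoc, hs]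
    field_simp

theorem exists_pos_mul_le_dotProduct_mulVec {n : Type*} [Fintype n] {M : Matrix n n ℝ}
    (hM : ∀ x ≠ 0, 0 < x ⬝ᵥ (M *ᵥ x)) :
    ∃ c > 0, ∀ x, c * (x ⬝ᵥ x) ≤ x ⬝ᵥ (M *ᵥ x) := by
  obtain ⟨c, hc, h⟩ := isCompact_dotProduct_self_eq_one.exists_forall_le'
    (continuous_dotProduct_mulVec_self M).continuousOn (a := 0)
    fun x (hx : x ⬝ᵥ x = 1) => hM x (by rintro rfl; simp at hx)
  refine ⟨c, hc, fun x => ?_⟩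
  rcases eq_or_ne x 0 with rfl | hx
  · simp
  · obtain ⟨hpos, y, hy, hxy⟩ := exists_unit_dotProduct_mulVec_self M hx
    rw [hxy]
    exact mul_le_mul_of_nonneg_right (h y hy) hpos.le

theorem exists_dotProduct_mulVec_le_mul {n : Type*} [Fintype n] (M : Matrix n n ℝ) :
    ∃ c, ∀ x, x ⬝ᵥ (M *ᵥ x) ≤ c * (x ⬝ᵥ x) := by
  obtain ⟨c, h⟩ := isCompact_dotProduct_self_eq_one.bddAbove_image
    (continuous_dotProduct_mulVec_self M).continuousOn
  refine ⟨c, fun x => ?_⟩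
  rcases eq_or_ne x 0 with rfl | hx
  · simp
  · obtain ⟨hpos, y, hy, hxy⟩ := exists_unit_dotProduct_mulVec_self M hx
    rw [hxy]
    exact mul_le_mul_of_nonneg_right (h ⟨y, hy, rfl⟩) hpos.le

theorem exists_pos_forall_le {ι : Type*} [Finite ι] (c : ι → ℝ) (hc : ∀ i, 0 < c i) :
    ∃ a > 0, ∀ i, a ≤ c i := by
  cases isEmpty_or_nonempty ι
  · exact ⟨1, one_pos, isEmptyElim⟩
  · obtain ⟨i, hi⟩ := Finite.exists_min c
    exact ⟨c i, hc i, hi⟩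

theorem le_sum_mul_of_forall_le {ι : Type*} [Fintype ι] {w f : ι → ℝ} {c : ℝ}
    (hw : ∀ i, 0 ≤ w i) (hw1 : ∑ i, w i = 1) (h : ∀ i, c ≤ f i) : c ≤ ∑ i, w i * f i :=
  calc c = ∑ i, w i * c := by rw [← Finset.sum_mul, hw1, one_mul]
    _ ≤ _ := Finset.sum_le_sum fun i _ => mul_le_mul_of_nonneg_left (h i) (hw i)

theorem dotProduct_sum_smul_mulVec {ι m n : Type*} [Fintype ι] [Fintype m] [Fintype n]
    (w : ι → ℝ) (M : ι → Matrix m n ℝ) (x : m → ℝ) (y : n → ℝ) :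
    x ⬝ᵥ ((∑ i, w i • M i) *ᵥ y) = ∑ i, w i * (x ⬝ᵥ (M i *ᵥ y)) := by
  simp [sum_mulVec, dotProduct_sum, smul_mulVec, dotProduct_smul]

theorem Matrix.IsHermitian.dotProduct_mulVec_comm {n : Type*} [Fintype n] {M : Matrix n n ℝ}
    (hM : M.IsHermitian) (x y : n → ℝ) : x ⬝ᵥ (M *ᵥ y) = y ⬝ᵥ (M *ᵥ x) := by
  rw [dotProduct_mulVec, ← mulVec_transpose, dotProduct_comm]
  congr 2

/-- Expansion of the nonnegative quantity `(x - y)ᵀM(x - y)`. -/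
theorem Matrix.PosDef.two_mul_dotProduct_mulVec_le {n : Type*} [Fintype n] {M : Matrix n n ℝ}
    (hM : M.PosDef) (x y : n → ℝ) :
    2 * (x ⬝ᵥ (M *ᵥ y)) ≤ x ⬝ᵥ (M *ᵥ x) + y ⬝ᵥ (M *ᵥ y) := by
  have h := hM.posSemidef.dotProduct_mulVec_nonneg (x - y)
  simp only [star_trivial, mulVec_sub, sub_dotProduct, dotProduct_sub] at h
  linarith [hM.isHermitian.dotProduct_mulVec_comm x y]

/-- The slack-variable linear matrix inequality implies the Lyapunov inequality
`S⁻¹ - AᵀT⁻¹A ≻ 0`. -/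
theorem dotProduct_inv_sub_mulVec_pos_of_fromBlocks {n : Type*} [Fintype n] [DecidableEq n]
    {A S T X : Matrix n n ℝ} (hS : S.PosDef) (hT : T.PosDef)
    (h : (fromBlocks (X + Xᵀ - S) (Xᵀ * Aᵀ) (A * X) T).PosDef) (x : n → ℝ) (hx : x ≠ 0) :
    0 < x ⬝ᵥ ((S⁻¹ - Aᵀ * T⁻¹ * A) *ᵥ x) := by
  have key : ∀ u w : n → ℝ, u ≠ 0 → 0 < 2 * (u ⬝ᵥ (X *ᵥ u)) - u ⬝ᵥ (S *ᵥ u)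
      - 2 * (w ⬝ᵥ (A *ᵥ (X *ᵥ u))) + w ⬝ᵥ (T *ᵥ w) := by
    intro u w hu
    have h1 := h.dotProduct_mulVec_pos (x := Sum.elim u (-w)) fun h0 => hu <| by
      ext i
      exact congrFun h0 (Sum.inl i)
    have hX : u ⬝ᵥ (Xᵀ *ᵥ u) = u ⬝ᵥ (X *ᵥ u) := by
      rw [mulVec_transpose, dotProduct_comm, dotProduct_mulVec]
    have hAX : u ⬝ᵥ ((Xᵀ * Aᵀ) *ᵥ w) = w ⬝ᵥ (A *ᵥ (X *ᵥ u)) := by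
      rw [← transpose_mul, mulVec_transpose, dotProduct_comm, ← dotProduct_mulVec, mulVec_mulVec]
    simp only [star_trivial, fromBlocks_mulVec, Sum.elim_comp_inl, Sum.elim_comp_inr,
      sumElim_dotProduct_sumElim, dotProduct_add, mulVec_neg, dotProduct_neg, neg_dotProduct,
      add_mulVec, sub_mulVec, dotProduct_sub, hX, ← mulVec_mulVec] at h1
    rw [mulVec_mulVec, hAX] at h1
    linarith
  have hXu : IsUnit X := by
    rw [← mulVec_injective_iff_isUnit, ← coe_mulVecLin, injective_iff_map_eq_zero]
    intro u hu
    by_contra hne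
    have h1 := key u 0 hne
    have h2 := hS.posSemidef.dotProduct_mulVec_nonneg u
    simp only [mulVecLin_apply] at hu
    simp [hu] at h1 h2
    linarith
  obtain ⟨u, rfl⟩ := mulVec_surjective_iff_isUnit.2 hXu x
  have hSi : S * S⁻¹ = 1 := mul_nonsing_inv S ((isUnit_iff_isUnit_det S).1 hS.isUnit)
  have hTi : T * T⁻¹ = 1 := mul_nonsing_inv T ((isUnit_iff_isUnit_det T).1 hT.isUnit)
  have h1 := key u (T⁻¹ *ᵥ (A *ᵥ (X *ᵥ u))) (by rintro rfl; simp at hx)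
  have h2 := hS.two_mul_dotProduct_mulVec_le u (S⁻¹ *ᵥ (X *ᵥ u))
  rw [mulVec_mulVec _ T, hTi, one_mulVec] at h1
  rw [mulVec_mulVec _ S, hSi, one_mulVec, dotProduct_comm (S⁻¹ *ᵥ _)] at h2
  rw [sub_mulVec, dotProduct_sub, ← mulVec_mulVec, ← mulVec_mulVec, dotProduct_mulVec _ Aᵀ,
    vecMul_transpose, dotProduct_comm (A *ᵥ _)]
  linarith




/-- Lemma 1 (L1.2 ⇒ L1.1): the slack-variable LMIs imply that
`V(π,x) = xᵀP(π)x`, with `P̄ᵢ = S̄ᵢ⁻¹`, is a poly-quadratic Lyapunov function for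
the polytopic system `x_{k+1} = A(p_k)x_k`; in particular the system is
poly-quadratically stable. -/
theorem lmi_implies_polyQS (nx np N : ℕ) (hnx : 0 < nx) (hnp : 0 < np) (hN : 0 < N)
    (Pset : Set (Fin np → ℝ)) (hPc : IsCompact Pset)
    (ξ : Fin N → Pset → ℝ)
    (hξc : ∀ i, Continuous (ξ i))
    (hξ0 : ∀ i π, 0 ≤ ξ i π)
    (hξ1 : ∀ π, ∑ i, ξ i π = 1)
    (A S X : Fin N → Matrix (Fin nx) (Fin nx) ℝ)
    (hS : ∀ i, (S i).PosDef)
    (hLMI : ∀ i j, (fromBlocks (X i + (X i)ᵀ - S i) ((X i)ᵀ * (A i)ᵀ)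
        (A i * X i) (S j)).PosDef) :
    ∃ a₁ a₂ a₃ : ℝ, 0 < a₁ ∧ 0 < a₂ ∧ 0 < a₃ ∧
      (∀ (π : Pset) (x : Fin nx → ℝ),
        a₁ * (x ⬝ᵥ x) ≤ x ⬝ᵥ ((∑ i, ξ i π • (S i)⁻¹) *ᵥ x) ∧
        x ⬝ᵥ ((∑ i, ξ i π • (S i)⁻¹) *ᵥ x) ≤ a₂ * (x ⬝ᵥ x)) ∧
      (∀ (π πplus : Pset) (x : Fin nx → ℝ),
        ((∑ i, ξ i π • A i) *ᵥ x) ⬝ᵥ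
            ((∑ i, ξ i πplus • (S i)⁻¹) *ᵥ ((∑ i, ξ i π • A i) *ᵥ x))
          ≤ x ⬝ᵥ ((∑ i, ξ i π • (S i)⁻¹) *ᵥ x) - a₃ * (x ⬝ᵥ x)) := by
  have hP : ∀ i, (S i)⁻¹.PosDef := fun i => (hS i).inv
  choose l hl0 hl using fun i => exists_pos_mul_le_dotProduct_mulVec (M := (S i)⁻¹)
    fun x hx => by simpa using (hP i).dotProduct_mulVec_pos hx
  choose b hb using fun i => exists_dotProduct_mulVec_le_mul (S i)⁻¹
  choose d hd0 hd using fun k : Fin N × Fin N => exists_pos_mul_le_dotProduct_mulVec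
    (dotProduct_inv_sub_mulVec_pos_of_fromBlocks (hS k.1) (hS k.2) (hLMI k.1 k.2))
  obtain ⟨a₁, ha₁, hl'⟩ := exists_pos_forall_le l hl0
  obtain ⟨a₃, ha₃, hd'⟩ := exists_pos_forall_le d hd0
  have hx0 : ∀ x : Fin nx → ℝ, 0 ≤ x ⬝ᵥ x := fun x => by
    simpa using dotProduct_self_star_nonneg x
  refine ⟨a₁, 1 + ∑ i, |b i|, a₃, ha₁, by positivity, ha₃, fun π x => ⟨?_, ?_⟩,
    fun π πplus x => ?_⟩
  · rw [dotProduct_sum_smul_mulVec]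
    exact le_sum_mul_of_forall_le (fun i => hξ0 i π) (hξ1 π) fun i =>
      (mul_le_mul_of_nonneg_right (hl' i) (hx0 x)).trans (hl i x)
  · rw [dotProduct_sum_smul_mulVec, ← neg_le_neg_iff, ← Finset.sum_neg_distrib]
    simp_rw [← mul_neg (ξ _ π)]
    refine le_sum_mul_of_forall_le (fun i => hξ0 i π) (hξ1 π) fun i => neg_le_neg ?_
    have hbi : b i ≤ 1 + ∑ j, |b j| := by
      linarith [le_abs_self (b i), Finset.single_le_sum (f := fun j => |b j|)
        (fun j _ => abs_nonneg _) (Finset.mem_univ i)]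
    exact (hb i x).trans (mul_le_mul_of_nonneg_right hbi (hx0 x))
  · set z := (∑ i, ξ i π • A i) *ᵥ x with hz
    have hij : ∀ j i, a₃ * (x ⬝ᵥ x) ≤ x ⬝ᵥ ((S i)⁻¹ *ᵥ x)
        - 2 * (z ⬝ᵥ (((S j)⁻¹ * A i) *ᵥ x)) + z ⬝ᵥ ((S j)⁻¹ *ᵥ z) := by
      intro j i
      have h1 := (mul_le_mul_of_nonneg_right (hd' (i, j)) (hx0 x)).trans (hd (i, j) x)
      have h2 := (hP j).two_mul_dotProduct_mulVec_le z (A i *ᵥ x)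
      simp only [sub_mulVec, dotProduct_sub, ← mulVec_mulVec, dotProduct_mulVec _ (A i)ᵀ,
        vecMul_transpose] at h1
      rw [← mulVec_mulVec]
      linarith
    have hj : ∀ j, a₃ * (x ⬝ᵥ x) ≤ x ⬝ᵥ ((∑ i, ξ i π • (S i)⁻¹) *ᵥ x)
        - z ⬝ᵥ ((S j)⁻¹ *ᵥ z) := by
      intro j
      have h := le_sum_mul_of_forall_le (fun i => hξ0 i π) (hξ1 π) (hij j)
      have hzz : z ⬝ᵥ ((S j)⁻¹ *ᵥ z) = ∑ i, ξ i π * (z ⬝ᵥ (((S j)⁻¹ * A i) *ᵥ x)) := by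
        rw [← dotProduct_sum_smul_mulVec]
        nth_rewrite 2 [hz]
        simp [mulVec_mulVec, Finset.mul_sum]
      simp only [mul_add, mul_sub, Finset.sum_add_distrib, Finset.sum_sub_distrib,
        mul_left_comm _ (2 : ℝ), ← Finset.mul_sum, ← Finset.sum_mul, hξ1, ← hzz,
        ← dotProduct_sum_smul_mulVec] at h
      linarith
    have h := le_sum_mul_of_forall_le (fun j => hξ0 j πplus) (hξ1 πplus) hj
    simp only [mul_sub, Finset.sum_sub_distrib, ← Finset.sum_mul, hξ1,
      ← dotProduct_sum_smul_mulVec] at h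
    linarith
end

section
/- Let P, Q ∈ ℝ^{n_x×n_x} be symmetric positive definite, A ∈ ℝ^{n_x×n_x} and C ∈ ℝ^{n_y×n_x}, and suppose P − AᵀQA + CᵀC is positive definite. Set L := −A(P + CᵀC)⁻¹Cᵀ. Then Q⁻¹ − (A + LC)P⁻¹(A + LC)ᵀ is positive definite. -/
open Matrix

/-- Strict Schur complement exchange: if `Q` and `S - AᵀQA` are positive definite, then so is
`Q⁻¹ - A S⁻¹ Aᵀ`. -/
theorem Matrix.PosDef.inv_sub_mul_inv_mul_transpose {m n : Type*} [Fintype m] [DecidableEq m]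
    [Fintype n] [DecidableEq n] {S : Matrix n n ℝ} {Q : Matrix m m ℝ} {A : Matrix m n ℝ}
    (hQ : Q.PosDef) (h : (S - Aᵀ * Q * A).PosDef) :
    (Q⁻¹ - A * S⁻¹ * Aᵀ).PosDef := by
  have hQd : IsUnit Q.det := (isUnit_iff_isUnit_det Q).1 hQ.isUnit
  have hQA : (Aᵀ * Q * A).PosSemidef := by
    simpa using hQ.posSemidef.conjTranspose_mul_mul_same A
  have hS : S.PosDef := by simpa using h.add_posSemidef hQA
  have hWS : (S - Aᵀ * Q * A)⁻¹⁻¹ + Aᵀ * Q * Q⁻¹ * (Q * A) = S := by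
    rw [nonsing_inv_nonsing_inv _ ((isUnit_iff_isUnit_det _).1 h.isUnit),
      mul_nonsing_inv_cancel_right _ _ hQd, ← Matrix.mul_assoc, sub_add_cancel]
  have hinv := add_mul_mul_inv_eq_sub Q (Q * A) (S - Aᵀ * Q * A)⁻¹ (Aᵀ * Q) hQ.isUnit
    h.inv.isUnit (by rw [hWS]; exact hS.isUnit)
  rw [hWS, nonsing_inv_mul_cancel_left _ _ hQd, ← Matrix.mul_assoc (A * S⁻¹),
    mul_nonsing_inv_cancel_right _ _ hQd] at hinv
  rw [← hinv]
  refine (hQ.add_posSemidef ?_).inv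
  have hQT : Qᵀ = Q := by simpa using hQ.isHermitian.eq
  simpa [hQT, Matrix.mul_assoc] using
    h.inv.posSemidef.mul_mul_conjTranspose_same (Q * A)

/-- The key matrix inequality behind the sufficiency part of the poly-quadratic
detectability test: if `P - AᵀQA + CᵀC ≻ 0` then, with the observer gain
`L = -A(P + CᵀC)⁻¹Cᵀ`, one has `Q⁻¹ - (A + LC)P⁻¹(A + LC)ᵀ ≻ 0`. -/
theorem detectability_vertex_gain (nx ny : ℕ) (hnx : 0 < nx) (hny : 0 < ny)
    (P Q A : Matrix (Fin nx) (Fin nx) ℝ)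
    (C : Matrix (Fin ny) (Fin nx) ℝ)
    (hP : P.PosDef) (hQ : Q.PosDef)
    (h : (P - Aᵀ * Q * A + Cᵀ * C).PosDef)
    (L : Matrix (Fin nx) (Fin ny) ℝ)
    (hL : L = -(A * (P + Cᵀ * C)⁻¹ * Cᵀ)) :
    (Q⁻¹ - (A + L * C) * P⁻¹ * (A + L * C)ᵀ).PosDef := by
  have hS : (P + Cᵀ * C).PosDef := hP.add_posSemidef (by
    simpa using posSemidef_conjTranspose_mul_self C)
  have hPd : IsUnit P.det := (isUnit_iff_isUnit_det P).1 hP.isUnit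
  have hSd := (isUnit_iff_isUnit_det _).1 hS.isUnit
  have hschur : (Q⁻¹ - A * (P + Cᵀ * C)⁻¹ * Aᵀ).PosDef :=
    hQ.inv_sub_mul_inv_mul_transpose (by rwa [add_sub_right_comm])
  set S := P + Cᵀ * C with hSdef
  have hPT : Pᵀ = P := by simpa using hP.isHermitian.eq
  have hST : S⁻¹ᵀ = S⁻¹ := by simpa using hS.inv.isHermitian.eq
  have hPS : P = S - Cᵀ * C := by rw [hSdef, add_sub_cancel_right]
  have hgain : A + L * C = A * S⁻¹ * P := by
    rw [hL, hPS, Matrix.mul_sub, nonsing_inv_mul_cancel_right _ _ hSd, Matrix.neg_mul,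
      ← sub_eq_add_neg]
    simp only [Matrix.mul_assoc]
  have hquad : (A + L * C) * P⁻¹ * (A + L * C)ᵀ
      = A * S⁻¹ * Aᵀ - (A * S⁻¹ * Cᵀ) * (A * S⁻¹ * Cᵀ)ᵀ := by
    rw [hgain, mul_nonsing_inv_cancel_right _ _ hPd]
    simp only [transpose_mul, transpose_transpose, hPT, hST]
    calc A * S⁻¹ * (P * (S⁻¹ * Aᵀ))
        = A * S⁻¹ * ((S - Cᵀ * C) * (S⁻¹ * Aᵀ)) := by rw [← hPS]
      _ = A * S⁻¹ * Aᵀ - A * S⁻¹ * Cᵀ * (C * (S⁻¹ * Aᵀ)) := by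
        rw [Matrix.sub_mul, mul_nonsing_inv_cancel_left _ _ hSd, Matrix.mul_sub]
        simp only [Matrix.mul_assoc]
  rw [hquad, ← sub_add]
  exact hschur.add_posSemidef (by
    simpa using posSemidef_self_mul_conjTranspose (A * S⁻¹ * Cᵀ))
end

section
/- Let P, Q ∈ ℝ^{n_x×n_x} be symmetric positive definite, A ∈ ℝ^{n_x×n_x} and C ∈ ℝ^{n_y×n_x}. If P + CᵀC − AᵀQA is positive definite, then Q⁻¹ − A(P + CᵀC)⁻¹Aᵀ is positive definite. -/
open Matrix

/-- If `M - BᴴQB` and `Q` are positive definite and `M` is invertible, then so is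
`Q⁻¹ - B M⁻¹ Bᴴ`, which is the inverse of `Q + QB (M - BᴴQB)⁻¹ (QB)ᴴ` by the Woodbury identity. -/
theorem Matrix.PosDef.inv_sub_mul_inv_mul_conjTranspose {m n : Type*} [Fintype m] [Fintype n]
    [DecidableEq m] [DecidableEq n] {Q : Matrix m m ℝ} {M : Matrix n n ℝ} {B : Matrix m n ℝ}
    (hQ : Q.PosDef) (hM : IsUnit M) (h : (M - Bᴴ * Q * B).PosDef) :
    (Q⁻¹ - B * M⁻¹ * Bᴴ).PosDef := by
  have hQu : IsUnit Q.det := (isUnit_iff_isUnit_det Q).1 hQ.isUnit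
  have hSu : IsUnit (M - Bᴴ * Q * B).det := (isUnit_iff_isUnit_det _).1 h.isUnit
  have hsum : (M - Bᴴ * Q * B)⁻¹⁻¹ + Bᴴ * Q * Q⁻¹ * (Q * B) = M := by
    rw [nonsing_inv_nonsing_inv _ hSu, mul_nonsing_inv_cancel_right _ _ hQu, ← Matrix.mul_assoc,
      sub_add_cancel]
  have key := add_mul_mul_inv_eq_sub Q (Q * B) (M - Bᴴ * Q * B)⁻¹ (Bᴴ * Q) hQ.isUnit
    h.inv.isUnit (hsum.symm ▸ hM)
  rw [hsum, nonsing_inv_mul_cancel_left _ _ hQu, ← Matrix.mul_assoc (B * M⁻¹),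
    mul_nonsing_inv_cancel_right _ _ hQu] at key
  have hpos := (hQ.add_posSemidef (h.inv.posSemidef.mul_mul_conjTranspose_same (Q * B))).inv
  rwa [conjTranspose_mul, hQ.isHermitian.eq, key] at hpos

/-- Double-Schur-complement step in the proof of the sufficiency of the
poly-quadratic detectability test: if `P + CᵀC - AᵀQA ≻ 0` then
`Q⁻¹ - A(P + CᵀC)⁻¹Aᵀ ≻ 0`. -/
theorem double_schur_detectability (nx ny : ℕ) (hnx : 0 < nx) (hny : 0 < ny)
    (P Q A : Matrix (Fin nx) (Fin nx) ℝ)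
    (C : Matrix (Fin ny) (Fin nx) ℝ)
    (hP : P.PosDef) (hQ : Q.PosDef)
    (h : (P + Cᵀ * C - Aᵀ * Q * A).PosDef) :
    (Q⁻¹ - A * (P + Cᵀ * C)⁻¹ * Aᵀ).PosDef := by
  have hM : (P + Cᵀ * C).PosDef := by
    simpa using hP.add_posSemidef (posSemidef_conjTranspose_mul_self C)
  simpa using hQ.inv_sub_mul_inv_mul_conjTranspose hM.isUnit (B := A) (by simpa using h)
end

section
/- Let S, S₊ ∈ ℝ^{n_x×n_x} be symmetric positive definite, A ∈ ℝ^{n_x×n_x} and B ∈ ℝ^{n_x×n_u}, and suppose S₊ − ASAᵀ + BBᵀ is positive definite. Set K := −Bᵀ(S₊ + BBᵀ)⁻¹A. Then S⁻¹ − (A + BK)ᵀS₊⁻¹(A + BK) is positive definite. -/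
open Matrix

theorem Matrix.dotProduct_transpose_mul_mul_mulVec {R m n : Type*} [CommSemiring R] [StarRing R]
    [TrivialStar R] [Fintype m] [Fintype n] (M : Matrix m m R) (L : Matrix m n R) (x : n → R) :
    star x ⬝ᵥ ((Lᵀ * M * L) *ᵥ x) = star (L *ᵥ x) ⬝ᵥ (M *ᵥ (L *ᵥ x)) := by
  simp only [star_trivial, ← mulVec_mulVec]
  rw [dotProduct_mulVec, vecMul_transpose]

/-- The congruences by `C` and by `1 - D * C` have no common kernel, so the corresponding sum of
positive definite forms is positive definite. -/
theorem Matrix.PosDef.one_sub_mul_congr_add_congr {m n : Type*} [Fintype m] [Fintype n]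
    [DecidableEq n] {P : Matrix n n ℝ} {Q : Matrix m m ℝ} (hP : P.PosDef) (hQ : Q.PosDef)
    (C : Matrix m n ℝ) (D : Matrix n m ℝ) :
    ((1 - D * C)ᵀ * P * (1 - D * C) + Cᵀ * Q * C).PosDef := by
  have h₁ := hP.posSemidef.conjTranspose_mul_mul_same (1 - D * C)
  have h₂ := hQ.posSemidef.conjTranspose_mul_mul_same C
  rw [conjTranspose_eq_transpose_of_trivial] at h₁ h₂
  refine .of_dotProduct_mulVec_pos (h₁.add h₂).isHermitian fun x hx => ?_
  rw [add_mulVec, dotProduct_add]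
  by_cases hC : C *ᵥ x = 0
  · have hL : (1 - D * C) *ᵥ x = x := by
      rw [sub_mulVec, one_mulVec, ← mulVec_mulVec, hC, mulVec_zero, sub_zero]
    refine add_pos_of_pos_of_nonneg ?_ (h₂.dotProduct_mulVec_nonneg x)
    rw [dotProduct_transpose_mul_mul_mulVec, hL]
    exact hP.dotProduct_mulVec_pos hx
  · refine add_pos_of_nonneg_of_pos (h₁.dotProduct_mulVec_nonneg x) ?_
    rw [dotProduct_transpose_mul_mul_mulVec]
    exact hQ.dotProduct_mulVec_pos hC

/-- The key matrix inequality behind the sufficiency part of the poly-quadratic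
stabilizability test: if `S₊ - ASAᵀ + BBᵀ ≻ 0` then, with the feedback gain
`K = -Bᵀ(S₊ + BBᵀ)⁻¹A`, one has `S⁻¹ - (A + BK)ᵀS₊⁻¹(A + BK) ≻ 0`. -/
theorem stabilizability_vertex_gain (nx nu : ℕ) (hnx : 0 < nx) (hnu : 0 < nu)
    (S Splus A : Matrix (Fin nx) (Fin nx) ℝ)
    (B : Matrix (Fin nx) (Fin nu) ℝ)
    (hS : S.PosDef) (hSplus : Splus.PosDef)
    (h : (Splus - A * S * Aᵀ + B * Bᵀ).PosDef)
    (K : Matrix (Fin nu) (Fin nx) ℝ)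
    (hK : K = -(Bᵀ * (Splus + B * Bᵀ)⁻¹ * A)) :
    (S⁻¹ - (A + B * K)ᵀ * Splus⁻¹ * (A + B * K)).PosDef := by
  have hG : (B * Bᵀ).PosSemidef := by
    simpa only [conjTranspose_eq_transpose_of_trivial] using posSemidef_self_mul_conjTranspose B
  have hW : IsUnit (Splus + B * Bᵀ).det :=
    (isUnit_iff_isUnit_det _).mp (hSplus.add_posSemidef hG).isUnit
  have hSdet : IsUnit S.det := (isUnit_iff_isUnit_det _).mp hS.isUnit
  have hSplusdet : IsUnit Splus.det := (isUnit_iff_isUnit_det _).mp hSplus.isUnit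
  have hST : Sᵀ = S := hS.isHermitian
  have hSplusT : Splusᵀ = Splus := hSplus.isHermitian
  set C := (Splus + B * Bᵀ)⁻¹ * A with hC
  have hA : A = (Splus + B * Bᵀ) * C := (mul_nonsing_inv_cancel_left _ _ hW).symm
  have hclosed : A + B * K = Splus * C := by
    have hBK : B * K = -(B * Bᵀ * C) := by
      rw [hK, hC]
      simp only [Matrix.mul_neg, Matrix.mul_assoc]
    rw [hBK]
    nth_rewrite 1 [hA]
    rw [Matrix.add_mul, add_neg_cancel_right]
  have hleft : (Splus * C)ᵀ * Splus⁻¹ * (Splus * C) = Cᵀ * Splus * C := by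
    rw [Matrix.mul_assoc, nonsing_inv_mul_cancel_left _ _ hSplusdet, transpose_mul, hSplusT]
  have hAT : Aᵀ = Cᵀ * (Splus + B * Bᵀ) := by
    conv_lhs => rw [hA]
    simp only [transpose_mul, transpose_add, transpose_transpose, hSplusT]
  have hcongr : (1 - S * Aᵀ * C)ᵀ * S⁻¹ * (1 - S * Aᵀ * C) =
      S⁻¹ - Aᵀ * C - Cᵀ * A + Cᵀ * A * S * Aᵀ * C := by
    have hT : (1 - S * Aᵀ * C)ᵀ = 1 - Cᵀ * A * S := by
      simp only [transpose_sub, transpose_one, transpose_mul, transpose_transpose, hST,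
        Matrix.mul_assoc]
    have hinv : (1 - Cᵀ * A * S) * S⁻¹ = S⁻¹ - Cᵀ * A := by
      rw [Matrix.sub_mul, Matrix.one_mul, mul_nonsing_inv_cancel_right _ _ hSdet]
    have hinv' : S⁻¹ * (S * Aᵀ * C) = Aᵀ * C := by
      rw [Matrix.mul_assoc S, nonsing_inv_mul_cancel_left _ _ hSdet]
    rw [hT, hinv, Matrix.mul_sub, Matrix.mul_one, Matrix.sub_mul, hinv']
    noncomm_ring
  have key : S⁻¹ - Cᵀ * Splus * C = (1 - S * Aᵀ * C)ᵀ * S⁻¹ * (1 - S * Aᵀ * C) +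
      Cᵀ * (Splus - A * S * Aᵀ + B * Bᵀ + B * Bᵀ) * C := by
    have hATC : Aᵀ * C = Cᵀ * Splus * C + Cᵀ * (B * Bᵀ) * C := by
      rw [hAT]
      noncomm_ring
    have hCTA : Cᵀ * A = Cᵀ * Splus * C + Cᵀ * (B * Bᵀ) * C := by
      conv_lhs => rw [hA]
      noncomm_ring
    have hexpand : Cᵀ * (Splus - A * S * Aᵀ + B * Bᵀ + B * Bᵀ) * C =
        Cᵀ * Splus * C - Cᵀ * A * S * Aᵀ * C + Cᵀ * (B * Bᵀ) * C + Cᵀ * (B * Bᵀ) * C := by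
      simp only [Matrix.mul_add, Matrix.mul_sub, Matrix.add_mul, Matrix.sub_mul, Matrix.mul_assoc]
    rw [hcongr, hexpand, hATC]
    nth_rewrite 1 [hCTA]
    abel
  rw [hclosed, hleft, key]
  exact hS.inv.one_sub_mul_congr_add_congr (h.add_posSemidef hG) C (S * Aᵀ)
end

section
/- If a strictly polytopic system with input matrix B is poly-quadratically stabilizable, then there exist symmetric positive definite matrices S̄_i ∈ ℝ^{n_x×n_x} (i = 1,…,N) such that S̄_j − A_iS̄_iA_iᵀ + BBᵀ is positive definite for all i, j ∈ {1,…,N}. -/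
open Matrix

/-- The polytopic system with input matrix `B` is poly-quadratically
stabilizable: some feedback gain `K` renders the closed-loop system
`x_{k+1} = (A(p_k)+BK(k,p))x_k` poly-quadratically stable with a poly-quadratic
Lyapunov function built from symmetric matrices `P̄ᵢ`. -/
def PolyQStabilizable (nx nu np N : ℕ) (Pset : Set (Fin np → ℝ))
    (ξ : Fin N → Pset → ℝ) (A : Fin N → Matrix (Fin nx) (Fin nx) ℝ)
    (B : Matrix (Fin nx) (Fin nu) ℝ) : Prop :=
  ∃ (K : ℕ → (ℕ → Pset) → Matrix (Fin nu) (Fin nx) ℝ)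
    (Pb : Fin N → Matrix (Fin nx) (Fin nx) ℝ),
    (∀ i, (Pb i).IsSymm) ∧
    ∃ a₁ a₂ a₃ : ℝ, 0 < a₁ ∧ 0 < a₂ ∧ 0 < a₃ ∧
      (∀ (π : Pset) (x : Fin nx → ℝ),
        a₁ * (x ⬝ᵥ x) ≤ x ⬝ᵥ ((∑ i, ξ i π • Pb i) *ᵥ x) ∧
        x ⬝ᵥ ((∑ i, ξ i π • Pb i) *ᵥ x) ≤ a₂ * (x ⬝ᵥ x)) ∧
      (∀ (p : ℕ → Pset) (k : ℕ) (x : Fin nx → ℝ),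
        (((∑ i, ξ i (p k) • A i) + B * K k p) *ᵥ x) ⬝ᵥ
            ((∑ i, ξ i (p (k + 1)) • Pb i) *ᵥ
              (((∑ i, ξ i (p k) • A i) + B * K k p) *ᵥ x))
          ≤ x ⬝ᵥ ((∑ i, ξ i (p k) • Pb i) *ᵥ x) - a₃ * (x ⬝ᵥ x))

/-- Finsler's lemma: a quadratic form that is positive on the kernel of `Bᵀ` becomes positive
definite after adding a large enough multiple of `B Bᵀ`. -/
lemma exists_forall_ge_quadForm_add_pos {n m : ℕ} (Q : Matrix (Fin n) (Fin n) ℝ)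
    (B : Matrix (Fin n) (Fin m) ℝ)
    (h : ∀ y, y ≠ 0 → Bᵀ *ᵥ y = 0 → 0 < y ⬝ᵥ (Q *ᵥ y)) :
    ∃ μ₀ : ℝ, ∀ μ, μ₀ ≤ μ → ∀ y, y ≠ 0 →
      0 < y ⬝ᵥ (Q *ᵥ y) + μ * ((Bᵀ *ᵥ y) ⬝ᵥ (Bᵀ *ᵥ y)) := by
  let q : (Fin n → ℝ) → ℝ := fun y => y ⬝ᵥ (Q *ᵥ y)
  let b : (Fin n → ℝ) → ℝ := fun y => (Bᵀ *ᵥ y) ⬝ᵥ (Bᵀ *ᵥ y)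
  have hq : Continuous q := by fun_prop
  have hb : Continuous b := by fun_prop
  have hb0 : ∀ y, 0 ≤ b y := fun y =>
    Finset.sum_nonneg fun i _ => mul_self_nonneg _
  have hK : IsCompact (Metric.sphere (0 : Fin n → ℝ) 1 ∩ {y | q y ≤ 0}) :=
    (isCompact_sphere 0 1).inter_right (isClosed_le hq continuous_const)
  have hsphere : ∃ μ₀ : ℝ, ∀ u ∈ Metric.sphere (0 : Fin n → ℝ) 1,
      0 < q u + μ₀ * b u := by
    have hbpos : ∀ u ∈ Metric.sphere (0 : Fin n → ℝ) 1 ∩ {y | q y ≤ 0}, 0 < b u := by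
      rintro u ⟨hu, hqu⟩
      refine (hb0 u).lt_of_ne' fun hbu => ?_
      have hu0 : u ≠ 0 := by rintro rfl; simp at hu
      exact absurd (h u hu0 (dotProduct_self_eq_zero.mp hbu)) (not_lt.mpr hqu)
    obtain ⟨C, hC⟩ := (hK.image_of_continuousOn (f := fun u => (1 - q u) / b u)
      ((continuous_const.sub hq).continuousOn.div hb.continuousOn
        fun u hu => (hbpos u hu).ne')).bddAbove
    refine ⟨max C 0, fun u hu => ?_⟩
    by_cases hqu : q u ≤ 0
    · have h1 : (1 - q u) / b u ≤ max C 0 :=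
        (hC ⟨u, ⟨hu, hqu⟩, rfl⟩).trans (le_max_left _ _)
      rw [div_le_iff₀ (hbpos u ⟨hu, hqu⟩)] at h1
      linarith
    · have := mul_nonneg (le_max_right C 0) (hb0 u)
      linarith [not_le.mp hqu]
  obtain ⟨μ₀, hμ₀⟩ := hsphere
  refine ⟨μ₀, fun μ hμ y hy => ?_⟩
  have hny : 0 < ‖y‖ := norm_pos_iff.mpr hy
  have hu := hμ₀ (‖y‖⁻¹ • y) (by simp [norm_smul, hny.ne'])
  have hscale : q (‖y‖⁻¹ • y) + μ₀ * b (‖y‖⁻¹ • y) = ‖y‖⁻¹ ^ 2 * (q y + μ₀ * b y) := by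
    simp only [q, b, mulVec_smul, smul_dotProduct, dotProduct_smul, smul_eq_mul]
    ring
  rw [hscale] at hu
  have hpos : 0 < q y + μ₀ * b y := pos_of_mul_pos_right hu (by positivity)
  exact hpos.trans_le (by gcongr; exact hb0 y)

/-- If `M` strictly decreases the energy from `P` to `P'`, then `Mᵀ` strictly decreases the
dual energy from `P'⁻¹` to `P⁻¹`. -/
lemma dual_quadForm_lt {n : ℕ} {P P' M : Matrix (Fin n) (Fin n) ℝ}
    (hP : P.PosDef) (hP' : P'.PosDef)
    (h : ∀ x, x ≠ 0 → (M *ᵥ x) ⬝ᵥ (P' *ᵥ (M *ᵥ x)) < x ⬝ᵥ (P *ᵥ x))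
    {y : Fin n → ℝ} (hy : y ≠ 0) :
    (Mᵀ *ᵥ y) ⬝ᵥ (P⁻¹ *ᵥ (Mᵀ *ᵥ y)) < y ⬝ᵥ (P'⁻¹ *ᵥ y) := by
  have hy_pos : 0 < y ⬝ᵥ (P'⁻¹ *ᵥ y) := by simpa using hP'.inv.dotProduct_mulVec_pos hy
  set x := P⁻¹ *ᵥ (Mᵀ *ᵥ y) with hx
  by_cases hx0 : x = 0
  · simpa [hx0] using hy_pos
  have hPx : P *ᵥ x = Mᵀ *ᵥ y := by
    rw [hx, mulVec_mulVec, mul_nonsing_inv _ ((isUnit_iff_isUnit_det _).mp hP.isUnit),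
      one_mulVec]
  have hPv : P' *ᵥ (P'⁻¹ *ᵥ y) = y := by
    rw [mulVec_mulVec, mul_nonsing_inv _ ((isUnit_iff_isUnit_det _).mp hP'.isUnit), one_mulVec]
  have hdec := h x hx0
  have hMx : (Mᵀ *ᵥ y) ⬝ᵥ x = y ⬝ᵥ (M *ᵥ x) := by
    rw [dotProduct_mulVec y M, mulVec_transpose]
  have hsq : 0 ≤ (P'⁻¹ *ᵥ y - M *ᵥ x) ⬝ᵥ (P' *ᵥ (P'⁻¹ *ᵥ y - M *ᵥ x)) := by
    simpa using hP'.posSemidef.dotProduct_mulVec_nonneg (P'⁻¹ *ᵥ y - M *ᵥ x)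
  have hsymm : (P'⁻¹ *ᵥ y) ⬝ᵥ (P' *ᵥ (M *ᵥ x)) = y ⬝ᵥ (M *ᵥ x) := by
    have hT : P'ᵀ = P' := by simpa using hP'.isHermitian.eq
    rw [dotProduct_mulVec, ← mulVec_transpose, hT, hPv]
  rw [hPx, dotProduct_comm x, hMx] at hdec
  rw [mulVec_sub, hPv, sub_dotProduct, dotProduct_sub, dotProduct_sub, hsymm,
    dotProduct_comm (P'⁻¹ *ᵥ y) y, dotProduct_comm (M *ᵥ x) y] at hsq
  rw [hMx]
  linarith

/-- Necessity of the vertex LMIs for poly-quadratic stabilizability of a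
strictly polytopic system: `S̄ⱼ - AᵢS̄ᵢAᵢᵀ + BBᵀ ≻ 0` for all `i,j`. -/
theorem polyQ_stabilizability_necessity (nx nu np N : ℕ)
    (hnx : 0 < nx) (hnu : 0 < nu) (hnp : 0 < np) (hN : 0 < N)
    (Pset : Set (Fin np → ℝ)) (hPc : IsCompact Pset)
    (ξ : Fin N → Pset → ℝ)
    (hξc : ∀ i, Continuous (ξ i))
    (hξ0 : ∀ i π, 0 ≤ ξ i π)
    (hξ1 : ∀ π, ∑ i, ξ i π = 1)
    (hstrict : ∀ i : Fin N, ∃ π : Pset, ∀ j, ξ j π = if j = i then 1 else 0)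
    (A : Fin N → Matrix (Fin nx) (Fin nx) ℝ)
    (B : Matrix (Fin nx) (Fin nu) ℝ)
    (hstab : PolyQStabilizable nx nu np N Pset ξ A B) :
    ∃ S : Fin N → Matrix (Fin nx) (Fin nx) ℝ,
      (∀ i, (S i).PosDef) ∧
      ∀ i j, (S j - A i * S i * (A i)ᵀ + B * Bᵀ).PosDef := by
  obtain ⟨K, P, hsymm, a₁, a₂, a₃, ha₁, -, ha₃, hbd, hdec⟩ := hstab
  choose v hv using hstrict
  have hvP : ∀ i, ∑ j, ξ j (v i) • P j = P i := fun i => by simp [hv]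
  have hvA : ∀ i, ∑ j, ξ j (v i) • A j = A i := fun i => by simp [hv]
  have hself : ∀ x : Fin nx → ℝ, x ≠ 0 → 0 < x ⬝ᵥ x := fun x hx => by
    simpa using dotProduct_star_self_pos_iff.mpr hx
  have hP : ∀ i, (P i).PosDef := fun i =>
    PosDef.of_dotProduct_mulVec_pos (by simpa using hsymm i) fun x hx => by
      have := (hbd (v i) x).1
      rw [hvP] at this
      simpa using (mul_pos ha₁ (hself x hx)).trans_le this
  have hker : ∀ i j, ∀ y, y ≠ 0 → Bᵀ *ᵥ y = 0 →
      0 < y ⬝ᵥ (((P j)⁻¹ - A i * (P i)⁻¹ * (A i)ᵀ) *ᵥ y) := fun i j y hy hBy => by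
    let p : ℕ → Pset := fun k => if k = 0 then v i else v j
    have hlt := dual_quadForm_lt (M := A i + B * K 0 p) (hP i) (hP j) (fun x hx => by
      have := hdec p 0 x
      simp only [p, zero_add, one_ne_zero, if_true, if_false, hvP, hvA] at this
      exact this.trans_lt (sub_lt_self _ (mul_pos ha₃ (hself x hx)))) hy
    have hM : (A i + B * K 0 p)ᵀ *ᵥ y = (A i)ᵀ *ᵥ y := by
      rw [transpose_add, transpose_mul, add_mulVec, ← mulVec_mulVec, hBy, mulVec_zero, add_zero]
    rw [hM] at hlt
    rw [sub_mulVec, dotProduct_sub, ← mulVec_mulVec, ← mulVec_mulVec, dotProduct_mulVec y (A i),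
      ← mulVec_transpose]
    exact sub_pos.mpr hlt
  choose μ₀ hμ₀ using fun i j => exists_forall_ge_quadForm_add_pos _ B (hker i j)
  obtain ⟨C, hC⟩ := (Set.finite_range fun ij : Fin N × Fin N => μ₀ ij.1 ij.2).bddAbove
  have hμ : 0 < max C 1 := lt_max_of_lt_right one_pos
  set μ := max C 1
  have hS : ∀ i, (μ⁻¹ • (P i)⁻¹).PosDef := fun i => (hP i).inv.smul (inv_pos.mpr hμ)
  refine ⟨fun i => μ⁻¹ • (P i)⁻¹, hS, fun i j => PosDef.of_dotProduct_mulVec_pos ?_ ?_⟩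
  · refine ((hS j).isHermitian.sub ?_).add ?_
    · simpa using isHermitian_mul_mul_conjTranspose (A i) (hS i).isHermitian
    · simpa using isHermitian_mul_conjTranspose_self B
  · intro y hy
    have hpos := hμ₀ i j μ ((hC ⟨(i, j), rfl⟩).trans (le_max_left _ _)) y hy
    have hB : y ⬝ᵥ ((B * Bᵀ) *ᵥ y) = (Bᵀ *ᵥ y) ⬝ᵥ (Bᵀ *ᵥ y) := by
      rw [← mulVec_mulVec, dotProduct_mulVec y B, ← mulVec_transpose]
    have hQ : μ⁻¹ • (P j)⁻¹ - A i * (μ⁻¹ • (P i)⁻¹) * (A i)ᵀ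
        = μ⁻¹ • ((P j)⁻¹ - A i * (P i)⁻¹ * (A i)ᵀ) := by
      rw [smul_sub, Matrix.mul_smul, Matrix.smul_mul]
    rw [star_trivial, hQ, add_mulVec, dotProduct_add, hB, smul_mulVec, dotProduct_smul,
      smul_eq_mul]
    have := mul_pos (inv_pos.mpr hμ) hpos
    rwa [mul_add, inv_mul_cancel_left₀ hμ.ne'] at this
end

section
/- Let A_i ∈ ℝ^{n_x×n_x} (i = 1,…,N), B ∈ ℝ^{n_x×n_u}, and suppose there exist symmetric positive definite matrices S̄_i ∈ ℝ^{n_x×n_x} and matrices X_i ∈ ℝ^{n_x×n_x} (i = 1,…,N) such that the 2×2 block matrix [[X_i + X_iᵀ − A_iS̄_iA_iᵀ + BBᵀ, X_iᵀ],[X_i, S̄_j]] is positive definite for all i, j ∈ {1,…,N}. Then for all μ, ν in the standard simplex {λ ∈ ℝ^N : λ_i ≥ 0, Σ_{i=1}^N λ_i = 1}, setting A(μ) := Σ_{i=1}^N μ_iA_i, P(μ) := Σ_{i=1}^N μ_iS̄_i⁻¹ and S(μ) := P(μ)⁻¹, the matrix S(ν) − A(μ)S(μ)A(μ)ᵀ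 + BBᵀ is positive definite. -/
open Matrix

/-- A convex combination of positive definite matrices is positive definite. -/
lemma posDef_sum_smul_of_simplex {ι n : Type*} [Fintype ι] [Fintype n]
    {w : ι → ℝ} (hw0 : ∀ i, 0 ≤ w i) (hw1 : ∑ i, w i = 1)
    {M : ι → Matrix n n ℝ} (hM : ∀ i, (M i).PosDef) : (∑ i, w i • M i).PosDef := by
  classical
  obtain ⟨k, -, hk⟩ : ∃ k ∈ Finset.univ, 0 < w k :=
    Finset.exists_lt_of_sum_lt (f := fun _ => (0 : ℝ)) (by simp [hw1])
  rw [← Finset.add_sum_erase _ _ (Finset.mem_univ k)]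
  exact ((hM k).smul hk).add_posSemidef
    (posSemidef_sum _ fun i _ => (hM i).posSemidef.smul (hw0 i))

/-- Restricting a positive definite block matrix to the graph `{(v, C v)}` gives a positive
definite matrix. -/
lemma Matrix.PosDef.of_fromBlocks_graph {m n : Type*} [Fintype m] [Fintype n]
    {D : Matrix m m ℝ} {X : Matrix n m ℝ} {S : Matrix n n ℝ}
    (h : (fromBlocks D Xᵀ X S).PosDef) (C : Matrix n m ℝ) :
    (D + Xᵀ * C + Cᵀ * X + Cᵀ * S * C).PosDef := by
  classical
  have hinj : Function.Injective (fromRows (1 : Matrix m m ℝ) C).mulVec := fun v w hvw => by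
    simp only [fromRows_mulVec, one_mulVec] at hvw
    exact funext fun i => congrFun hvw (Sum.inl i)
  convert h.conjTranspose_mul_mul_same hinj using 1
  rw [conjTranspose_fromRows_eq_fromCols_conjTranspose, fromCols_mul_fromBlocks,
    fromCols_mul_fromRows]
  simp only [conjTranspose_eq_transpose_of_trivial, transpose_one, Matrix.mul_one,
    Matrix.one_mul, Matrix.add_mul]
  abel

/-- Multiplication on both sides commutes with linear combinations. -/
lemma sum_smul_mul_mul {ι l m n o : Type*} [Fintype ι] [Fintype m] [Fintype n] (w : ι → ℝ)
    (Y : Matrix l m ℝ) (M : ι → Matrix m n ℝ) (Z : Matrix n o ℝ) :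
    ∑ i, w i • (Y * M i * Z) = Y * (∑ i, w i • M i) * Z := by
  simp only [Matrix.mul_sum, Matrix.sum_mul, Matrix.mul_smul, Matrix.smul_mul]

/-- Joint convexity of `(A, P) ↦ A P⁻¹ Aᵀ`, parametrized by `S = P⁻¹`. -/
lemma posSemidef_sum_smul_sub_mul_inv_mul_transpose {ι m n : Type*} [Fintype ι] [Fintype m]
    [Fintype n] [DecidableEq n] {w : ι → ℝ} (hw0 : ∀ i, 0 ≤ w i) (hw1 : ∑ i, w i = 1)
    (A : ι → Matrix m n ℝ) {S : ι → Matrix n n ℝ} (hS : ∀ i, (S i).PosDef) :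
    (∑ i, w i • (A i * S i * (A i)ᵀ) -
      (∑ i, w i • A i) * (∑ i, w i • (S i)⁻¹)⁻¹ * (∑ i, w i • A i)ᵀ).PosSemidef := by
  have hP := posDef_sum_smul_of_simplex hw0 hw1 fun i => (hS i).inv
  set P := ∑ i, w i • (S i)⁻¹ with hPdef
  set Aw := ∑ i, w i • A i with hAw
  have hPu := (isUnit_iff_isUnit_det P).1 hP.isUnit
  have hPt : (P⁻¹)ᵀ = P⁻¹ := hP.inv.isHermitian
  have key : ∀ i, (A i * S i * (A i)ᵀ - A i * (P⁻¹ * Awᵀ) - Aw * P⁻¹ * (A i)ᵀ +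
      Aw * P⁻¹ * (S i)⁻¹ * (P⁻¹ * Awᵀ)).PosSemidef := fun i => by
    have hSu := (isUnit_iff_isUnit_det (S i)).1 (hS i).isUnit
    have hSt : (S i)ᵀ = S i := (hS i).isHermitian
    have hSinv : ((S i)⁻¹).PosSemidef := (hS i).inv.posSemidef
    convert hSinv.mul_mul_conjTranspose_same (A i * S i - Aw * P⁻¹) using 1
    simp only [conjTranspose_eq_transpose_of_trivial, transpose_sub, transpose_mul, hSt, hPt,
      Matrix.sub_mul, Matrix.mul_sub, mul_nonsing_inv_cancel_right _ _ hSu]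
    rw [Matrix.mul_assoc (Aw * P⁻¹) (S i)⁻¹ (S i * (A i)ᵀ), nonsing_inv_mul_cancel_left _ _ hSu]
    simp only [Matrix.mul_assoc]
    abel
  convert posSemidef_sum Finset.univ fun i _ => (key i).smul (hw0 i) using 1
  have h₁ : ∑ i, w i • (A i * (P⁻¹ * Awᵀ)) = Aw * P⁻¹ * Awᵀ := by
    simp only [← Matrix.smul_mul, ← Matrix.sum_mul, ← hAw, Matrix.mul_assoc]
  have h₂ : ∑ i, w i • (Aw * P⁻¹ * (A i)ᵀ) = Aw * P⁻¹ * Awᵀ := by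
    simp only [hAw, transpose_sum, transpose_smul, Matrix.mul_sum, Matrix.mul_smul]
  have h₃ : ∑ i, w i • (Aw * P⁻¹ * (S i)⁻¹ * (P⁻¹ * Awᵀ)) = Aw * P⁻¹ * Awᵀ := by
    rw [sum_smul_mul_mul, ← hPdef, nonsing_inv_mul_cancel_right _ _ hPu, Matrix.mul_assoc]
  simp only [smul_add, smul_sub, Finset.sum_add_distrib, Finset.sum_sub_distrib, h₁, h₂, h₃]
  abel

/-- If the block matrices `[[D, Xᵀ], [X, Sⱼ]]` are positive definite for all `j`, then so is
`D - X - Xᵀ + H`, where `H` is the weighted harmonic mean of the `Sⱼ`. -/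
lemma posDef_sub_add_inv_sum_smul_inv {ι n : Type*} [Fintype ι] [Fintype n] [DecidableEq n]
    {w : ι → ℝ} (hw0 : ∀ i, 0 ≤ w i) (hw1 : ∑ i, w i = 1) {D X : Matrix n n ℝ}
    {S : ι → Matrix n n ℝ} (hS : ∀ i, (S i).PosDef)
    (h : ∀ j, (fromBlocks D Xᵀ X (S j)).PosDef) :
    (D - X - Xᵀ + (∑ i, w i • (S i)⁻¹)⁻¹).PosDef := by
  have hP := posDef_sum_smul_of_simplex hw0 hw1 fun i => (hS i).inv
  set P := ∑ i, w i • (S i)⁻¹ with hPdef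
  have hPu := (isUnit_iff_isUnit_det P).1 hP.isUnit
  have hPt : (P⁻¹)ᵀ = P⁻¹ := hP.inv.isHermitian
  have key : ∀ j, (D - Xᵀ * (S j)⁻¹ * P⁻¹ - P⁻¹ * (S j)⁻¹ * X + P⁻¹ * (S j)⁻¹ * P⁻¹).PosDef :=
    fun j => by
      have hSu := (isUnit_iff_isUnit_det (S j)).1 (hS j).isUnit
      have hSt : ((S j)⁻¹)ᵀ = (S j)⁻¹ := (hS j).inv.isHermitian
      convert (h j).of_fromBlocks_graph (-((S j)⁻¹ * P⁻¹)) using 1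
      simp only [transpose_neg, transpose_mul, hSt, hPt, Matrix.neg_mul, Matrix.mul_neg, neg_neg,
        nonsing_inv_mul_cancel_right _ _ hSu, ← Matrix.mul_assoc]
      abel
  convert posDef_sum_smul_of_simplex hw0 hw1 key using 1
  have h₀ : ∑ i, w i • D = D := by rw [← Finset.sum_smul, hw1, one_smul]
  have hr : ∀ Y Z : Matrix n n ℝ, ∑ i, w i • (Y * (S i)⁻¹ * Z) = Y * P * Z := fun Y Z =>
    sum_smul_mul_mul w Y _ Z
  simp only [smul_add, smul_sub, Finset.sum_add_distrib, Finset.sum_sub_distrib, h₀, hr,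
    nonsing_inv_mul _ hPu, mul_nonsing_inv_cancel_right _ _ hPu, Matrix.one_mul]
  abel

/-- Key step in Theorem 3: the slack-variable LMIs at the vertices imply the
parameter-dependent inequality `S(ν) - A(μ)S(μ)A(μ)ᵀ + BBᵀ ≻ 0` for all `μ, ν`
in the standard simplex, where `A(μ) = Σᵢ μᵢAᵢ`, `P(μ) = Σᵢ μᵢS̄ᵢ⁻¹` and
`S(μ) = P(μ)⁻¹`. -/
theorem lmi_implies_param_dependent_ineq (nx nu N : ℕ)
    (hnx : 0 < nx) (hnu : 0 < nu) (hN : 0 < N)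
    (A : Fin N → Matrix (Fin nx) (Fin nx) ℝ)
    (B : Matrix (Fin nx) (Fin nu) ℝ)
    (S X : Fin N → Matrix (Fin nx) (Fin nx) ℝ)
    (hS : ∀ i, (S i).PosDef)
    (hLMI : ∀ i j, (fromBlocks (X i + (X i)ᵀ - A i * S i * (A i)ᵀ + B * Bᵀ)
        ((X i)ᵀ) (X i) (S j)).PosDef)
    (μ ν : Fin N → ℝ)
    (hμ0 : ∀ i, 0 ≤ μ i) (hμ1 : ∑ i, μ i = 1)
    (hν0 : ∀ i, 0 ≤ ν i) (hν1 : ∑ i, ν i = 1) :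
    ((∑ i, ν i • (S i)⁻¹)⁻¹ -
        (∑ i, μ i • A i) * (∑ i, μ i • (S i)⁻¹)⁻¹ * (∑ i, μ i • A i)ᵀ +
        B * Bᵀ).PosDef := by
  have hvertex := posDef_sum_smul_of_simplex hμ0 hμ1 fun i =>
    posDef_sub_add_inv_sum_smul_inv hν0 hν1 hS (hLMI i)
  convert hvertex.add_posSemidef
    (posSemidef_sum_smul_sub_mul_inv_mul_transpose hμ0 hμ1 A hS) using 1
  have hconst : ∀ M : Matrix (Fin nx) (Fin nx) ℝ, ∑ i, μ i • M = M := fun M => by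
    rw [← Finset.sum_smul, hμ1, one_smul]
  simp only [smul_add, smul_sub, Finset.sum_add_distrib, Finset.sum_sub_distrib, hconst]
  abel
end

section
/- Let ℙ ⊆ ℝ^p be a compact set and let Ψ : ℙ → ℝ^{n×n} (with Ψ(π) symmetric for every π) and Γ : ℙ → ℝ^{m×n} be continuous. The following are equivalent: (a) for every π ∈ ℙ and every nonzero x ∈ ℝⁿ with Γ(π)x = 0, it holds that xᵀΨ(π)x > 0; (b) there exists a real number μ such that Ψ(π) + μΓ(π)ᵀΓ(π) is positive definite for every π ∈ ℙ. -/
open Matrix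

/-- On a compact space, a continuous function that is positive on the zero set of a nonnegative
continuous function `g` becomes positive everywhere after adding a large multiple of `g`. -/
theorem exists_forall_pos_add_mul {X : Type*} [TopologicalSpace X] [CompactSpace X] {f g : X → ℝ}
    (hf : Continuous f) (hg : Continuous g) (hg0 : ∀ x, 0 ≤ g x) (hfg : ∀ x, g x = 0 → 0 < f x) :
    ∃ μ : ℝ, ∀ x, 0 < f x + μ * g x := by
  have hmono : Monotone fun N : ℕ => {x | 0 < f x + N * g x} := by
    intro M N hMN x (hx : 0 < f x + M * g x)
    have : (M : ℝ) * g x ≤ N * g x := by gcongr; exact hg0 x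
    show 0 < f x + N * g x
    linarith
  obtain ⟨N, hN⟩ := isCompact_univ.elim_directed_cover (fun N : ℕ => {x | 0 < f x + N * g x})
    (fun N => isOpen_lt continuous_const (by fun_prop))
    (fun x _ => by
      rw [Set.mem_iUnion]
      rcases (hg0 x).eq_or_lt with h | h
      · exact ⟨0, by simpa using hfg x h.symm⟩
      · obtain ⟨N, hN⟩ := exists_nat_gt (-f x / g x)
        refine ⟨N, ?_⟩
        rw [div_lt_iff₀ h] at hN
        show 0 < f x + N * g x
        linarith)
    hmono.directed_le
  exact ⟨N, fun x => hN (Set.mem_univ x)⟩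

/-- The quadratic form of `A + μ • (Bᵀ * B)`. -/
theorem dotProduct_add_smul_transpose_mul_self_mulVec {m n : ℕ} (A : Matrix (Fin n) (Fin n) ℝ)
    (B : Matrix (Fin m) (Fin n) ℝ) (μ : ℝ) (x : Fin n → ℝ) :
    x ⬝ᵥ ((A + μ • (Bᵀ * B)) *ᵥ x) = x ⬝ᵥ (A *ᵥ x) + μ * ((B *ᵥ x) ⬝ᵥ (B *ᵥ x)) := by
  rw [add_mulVec, dotProduct_add, smul_mulVec, dotProduct_smul, smul_eq_mul, ← mulVec_mulVec,
    dotProduct_mulVec x Bᵀ, vecMul_transpose]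

/-- A quadratic form that is positive on the unit sphere is positive away from the origin. -/
theorem dotProduct_mulVec_pos_of_sphere {n : ℕ} {A : Matrix (Fin n) (Fin n) ℝ}
    (hA : ∀ u : Metric.sphere (0 : Fin n → ℝ) 1, 0 < (u : Fin n → ℝ) ⬝ᵥ (A *ᵥ u))
    {x : Fin n → ℝ} (hx : x ≠ 0) : 0 < x ⬝ᵥ (A *ᵥ x) := by
  have hpos : 0 < ‖x‖⁻¹ := inv_pos.mpr (norm_pos_iff.mpr hx)
  have h := hA ⟨‖x‖⁻¹ • x, by simp [norm_smul, hx]⟩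
  simp only [mulVec_smul, dotProduct_smul, smul_dotProduct, smul_eq_mul] at h
  exact (mul_pos_iff_of_pos_left hpos).mp ((mul_pos_iff_of_pos_left hpos).mp h)

/-- Parameter-dependent Finsler-type lemma: for continuous `Ψ` (symmetric-valued)
and `Γ` on a compact set `ℙ`, positivity of `Ψ(π)` on the kernel of `Γ(π)` for all
`π` is equivalent to the existence of a single `μ ∈ ℝ` such that
`Ψ(π) + μΓ(π)ᵀΓ(π) ≻ 0` for all `π`. -/
theorem finsler_parametric (p n m : ℕ)
    (Pset : Set (Fin p → ℝ)) (hPc : IsCompact Pset)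
    (Ψ : Pset → Matrix (Fin n) (Fin n) ℝ)
    (Γ : Pset → Matrix (Fin m) (Fin n) ℝ)
    (hΨsymm : ∀ π, (Ψ π).IsSymm)
    (hΨc : Continuous Ψ) (hΓc : Continuous Γ) :
    (∀ (π : Pset) (x : Fin n → ℝ), x ≠ 0 → Γ π *ᵥ x = 0 → 0 < x ⬝ᵥ (Ψ π *ᵥ x)) ↔
    (∃ μ : ℝ, ∀ π : Pset, (Ψ π + μ • ((Γ π)ᵀ * Γ π)).PosDef) := by
  constructor
  · intro h
    have : CompactSpace Pset := isCompact_iff_compactSpace.mp hPc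
    obtain ⟨μ, hμ⟩ := exists_forall_pos_add_mul
      (X := Pset × Metric.sphere (0 : Fin n → ℝ) 1)
      (f := fun q => (q.2 : Fin n → ℝ) ⬝ᵥ (Ψ q.1 *ᵥ q.2))
      (g := fun q => (Γ q.1 *ᵥ q.2) ⬝ᵥ (Γ q.1 *ᵥ q.2))
      (by fun_prop) (by fun_prop)
      (fun q => by simpa using dotProduct_star_self_nonneg (Γ q.1 *ᵥ q.2))
      (fun q hq => h q.1 q.2 (ne_zero_of_mem_unit_sphere q.2) (dotProduct_self_eq_zero.mp hq))
    refine ⟨μ, fun π => .of_dotProduct_mulVec_pos ?_ fun x hx => ?_⟩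
    · rw [IsHermitian, conjTranspose_eq_transpose_of_trivial, transpose_add, transpose_smul,
        transpose_mul, transpose_transpose, hΨsymm π]
    · rw [star_trivial]
      refine dotProduct_mulVec_pos_of_sphere (fun u => ?_) hx
      rw [dotProduct_add_smul_transpose_mul_self_mulVec]
      exact hμ (π, u)
  · rintro ⟨μ, hμ⟩ π x hx hΓx
    have h := (hμ π).dotProduct_mulVec_pos hx
    rwa [star_trivial, dotProduct_add_smul_transpose_mul_self_mulVec, hΓx, dotProduct_zero,
      mul_zero, add_zero] at h
end

section
/- Let Ψ ∈ ℝ^{n×n} be symmetric, Γ ∈ ℝ^{m×n} and Ω ∈ ℝ^{p×n} with rank Ω = p < n. There exists a matrix Λ ∈ ℝ^{m×p} such that Ψ + ΓᵀΛΩ + ΩᵀΛᵀΓ is positive definite if and only if both of the following hold: (a) xᵀΨx > 0 for every nonzero x ∈ ℝⁿ with Γx = 0, and (b) xᵀΨx > 0 for every nonzero x ∈ ℝⁿ with Ωx = 0. -/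
open Matrix

/-- A linear map that vanishes on the kernel of `u` factors through `u`. -/
lemma LinearMap.exists_comp_eq_of_ker_le_ker {K U V W : Type*} [Field K]
    [AddCommGroup U] [Module K U] [AddCommGroup V] [Module K V] [AddCommGroup W] [Module K W]
    (u : U →ₗ[K] W) (f : U →ₗ[K] V) (h : LinearMap.ker u ≤ LinearMap.ker f) :
    ∃ g : W →ₗ[K] V, g ∘ₗ u = f := by
  obtain ⟨g, hg⟩ := LinearMap.exists_extend
    ((LinearMap.ker u).liftQ f h ∘ₗ u.quotKerEquivRange.symm.toLinearMap)
  refine ⟨g, LinearMap.ext fun x => ?_⟩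
  have hx := LinearMap.congr_fun hg ⟨u x, LinearMap.mem_range_self u x⟩
  have hs : u.quotKerEquivRange.symm ⟨u x, LinearMap.mem_range_self u x⟩ =
      (LinearMap.ker u).mkQ x := u.quotKerEquivRange_symm_apply_image x _
  simpa [hs] using hx

namespace Matrix

variable {ι κ : Type*} [Fintype ι] [Fintype κ]

/-- A linear map on a subspace that vanishes where `M` does is given by a matrix applied
after `M`. -/
lemma exists_mulVec_mulVec_eq {l : Type*} [DecidableEq κ] (M : Matrix κ ι ℝ)
    (N : Submodule ℝ (ι → ℝ))
    (f : (ι → ℝ) →ₗ[ℝ] (l → ℝ)) (h : ∀ x ∈ N, M *ᵥ x = 0 → f x = 0) :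
    ∃ A : Matrix l κ ℝ, ∀ x ∈ N, A *ᵥ (M *ᵥ x) = f x := by
  obtain ⟨g, hg⟩ := LinearMap.exists_comp_eq_of_ker_le_ker
    (M.mulVecLin ∘ₗ N.subtype) (f ∘ₗ N.subtype) (fun x hx => by
      simpa using h x x.2 (by simpa using hx))
  refine ⟨LinearMap.toMatrix' g, fun x hx => ?_⟩
  rw [LinearMap.toMatrix'_mulVec]
  exact LinearMap.congr_fun hg ⟨x, hx⟩

lemma IsSymm.dotProduct_mulVec_comm {S : Matrix ι ι ℝ} (hS : S.IsSymm) (x y : ι → ℝ) :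
    x ⬝ᵥ (S *ᵥ y) = y ⬝ᵥ (S *ᵥ x) := by
  rw [dotProduct_mulVec, ← mulVec_transpose, hS.eq, dotProduct_comm]

/-- The orthogonal projection onto a subspace on which `S` is positive definite, with respect
to the form `S`. -/
lemma exists_projection_of_pos (S : Matrix ι ι ℝ) (K : Submodule ℝ (ι → ℝ))
    (hK : ∀ x ∈ K, x ≠ 0 → 0 < x ⬝ᵥ (S *ᵥ x)) :
    ∃ q : (ι → ℝ) →ₗ[ℝ] (ι → ℝ), (∀ x, q x ∈ K) ∧ (∀ x ∈ K, q x = x) ∧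
      ∀ x, ∀ y ∈ K, y ⬝ᵥ (S *ᵥ (x - q x)) = 0 := by
  let B : (ι → ℝ) →ₗ[ℝ] Module.Dual ℝ K :=
    LinearMap.mk₂ ℝ (fun x (y : K) => (y : ι → ℝ) ⬝ᵥ (S *ᵥ x))
      (fun x x' y => by simp [mulVec_add]) (fun c x y => by simp [mulVec_smul])
      (fun x y y' => by simp) (fun c x y => by simp)
  have hB : ∀ x (y : K), B x y = (y : ι → ℝ) ⬝ᵥ (S *ᵥ x) := fun x y => rfl
  have hinj : Function.Injective (B ∘ₗ K.subtype) := by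
    rw [← LinearMap.ker_eq_bot, LinearMap.ker_eq_bot']
    intro x hx
    by_contra hne
    have h0 := hK x x.2 (by simpa using hne)
    have h1 := LinearMap.congr_fun hx x
    simp only [LinearMap.comp_apply, Submodule.subtype_apply, hB, LinearMap.zero_apply] at h1
    exact h0.ne' h1
  let e := LinearEquiv.ofInjectiveOfFinrankEq (B ∘ₗ K.subtype) hinj
    Subspace.dual_finrank_eq.symm
  have he : ∀ y : K, e y = B y := fun y => rfl
  refine ⟨K.subtype ∘ₗ e.symm.toLinearMap ∘ₗ B, fun x => by simp, fun x hx => ?_,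
    fun x y hy => ?_⟩
  · have := e.symm_apply_apply ⟨x, hx⟩
    rw [he] at this
    simp [this]
  · have := LinearMap.congr_fun (e.apply_symm_apply (B x)) ⟨y, hy⟩
    rw [he, hB, hB] at this
    simp [mulVec_sub, dotProduct_sub, this]

/-- Finsler's lemma: a form positive on the kernel of `T` becomes positive after adding a large
multiple of `‖T x‖²`. -/
lemma exists_pos_add_mul_dotProduct_self (S : Matrix ι ι ℝ) (T : Matrix κ ι ℝ)
    (h : ∀ x, x ≠ 0 → T *ᵥ x = 0 → 0 < x ⬝ᵥ (S *ᵥ x)) :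
    ∃ t : ℝ, ∀ x, x ≠ 0 → 0 < x ⬝ᵥ (S *ᵥ x) + t * (T *ᵥ x ⬝ᵥ T *ᵥ x) := by
  have hnn : ∀ x, 0 ≤ T *ᵥ x ⬝ᵥ T *ᵥ x := fun x =>
    Finset.sum_nonneg fun i _ => mul_self_nonneg _
  obtain ⟨k, hk⟩ := (isCompact_sphere (0 : ι → ℝ) 1).elim_directed_cover
    (fun k : ℕ => {x | 0 < x ⬝ᵥ (S *ᵥ x) + k * (T *ᵥ x ⬝ᵥ T *ᵥ x)})
    (fun k => isOpen_lt continuous_const (by fun_prop))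
    (fun x hx => by
      have hx0 : x ≠ 0 := by rintro rfl; simp at hx
      rw [Set.mem_iUnion]
      by_cases hT : T *ᵥ x = 0
      · exact ⟨0, by simpa [hT] using h x hx0 hT⟩
      · have hpos : 0 < T *ᵥ x ⬝ᵥ T *ᵥ x :=
          (hnn x).lt_of_ne' (by simpa using hT)
        obtain ⟨k, hk⟩ := exists_nat_gt (-(x ⬝ᵥ (S *ᵥ x)) / (T *ᵥ x ⬝ᵥ T *ᵥ x))
        rw [div_lt_iff₀ hpos] at hk
        exact ⟨k, by simp only [Set.mem_ofPred_eq]; linarith⟩)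
    (directed_of_isDirected_le fun i j hij x hx => by
      simp only [Set.mem_ofPred_eq] at hx ⊢
      have : (i : ℝ) ≤ j := by exact_mod_cast hij
      nlinarith [hnn x])
  refine ⟨k, fun x hx => ?_⟩
  have hn : 0 < ‖x‖ := norm_pos_iff.mpr hx
  have := @hk (‖x‖⁻¹ • x) (by simp [norm_smul, hn.ne'])
  simp only [Set.mem_ofPred_eq, mulVec_smul, dotProduct_smul, smul_dotProduct, smul_eq_mul] at this
  have h2 : 0 < ‖x‖⁻¹ * (‖x‖⁻¹ * (x ⬝ᵥ (S *ᵥ x) + k * (T *ᵥ x ⬝ᵥ T *ᵥ x))) := by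
    linarith
  have hi := inv_pos.mpr hn
  exact (mul_pos_iff_of_pos_left hi).mp ((mul_pos_iff_of_pos_left hi).mp h2)

lemma dotProduct_add_add_transpose_mulVec {l : Type*} [Fintype l] (S : Matrix ι ι ℝ) (G : Matrix κ ι ℝ)
    (O : Matrix l ι ℝ) (L : Matrix κ l ℝ) (x : ι → ℝ) :
    x ⬝ᵥ ((S + Gᵀ * L * O + Oᵀ * Lᵀ * G) *ᵥ x) =
      x ⬝ᵥ (S *ᵥ x) + 2 * (G *ᵥ x ⬝ᵥ (L *ᵥ (O *ᵥ x))) := by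
  have h1 : x ⬝ᵥ ((Gᵀ * L * O) *ᵥ x) = G *ᵥ x ⬝ᵥ (L *ᵥ (O *ᵥ x)) := by
    rw [← mulVec_mulVec, ← mulVec_mulVec, dotProduct_mulVec, vecMul_transpose]
  have h2 : x ⬝ᵥ ((Oᵀ * Lᵀ * G) *ᵥ x) = G *ᵥ x ⬝ᵥ (L *ᵥ (O *ᵥ x)) := by
    rw [← mulVec_mulVec, ← mulVec_mulVec, dotProduct_mulVec, vecMul_transpose,
      dotProduct_mulVec, vecMul_transpose, dotProduct_comm]
  rw [add_mulVec, add_mulVec, dotProduct_add, dotProduct_add, h1, h2]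
  ring

lemma dotProduct_transpose_mul_transpose_mul_mulVec (G : Matrix κ ι ℝ)
    {a b : Type*} [Fintype a] [Fintype b]
    (A : Matrix ι a ℝ) (B : Matrix κ b ℝ) (x : a → ℝ) (y : b → ℝ) :
    x ⬝ᵥ ((Aᵀ * Gᵀ * B) *ᵥ y) = G *ᵥ (A *ᵥ x) ⬝ᵥ (B *ᵥ y) := by
  rw [← mulVec_mulVec, ← transpose_mul, dotProduct_mulVec, vecMul_transpose, mulVec_mulVec]

/-- A coupling of `G` and `O` that makes the form positive on `ker G + ker O`. -/
lemma exists_pos_on_sup_ker {l : Type*} [Fintype l] [DecidableEq κ] [DecidableEq l]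
    {S : Matrix ι ι ℝ} (hS : S.IsSymm)
    (G : Matrix κ ι ℝ) (O : Matrix l ι ℝ)
    (hG : ∀ x, x ≠ 0 → G *ᵥ x = 0 → 0 < x ⬝ᵥ (S *ᵥ x))
    (hO : ∀ x, x ≠ 0 → O *ᵥ x = 0 → 0 < x ⬝ᵥ (S *ᵥ x)) :
    ∃ L : Matrix κ l ℝ, ∀ x ∈ LinearMap.ker G.mulVecLin ⊔ LinearMap.ker O.mulVecLin, x ≠ 0 →
      0 < x ⬝ᵥ (S *ᵥ x) + 2 * (G *ᵥ x ⬝ᵥ (L *ᵥ (O *ᵥ x))) := by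
  obtain ⟨q, hqK, hqid, hqo⟩ := exists_projection_of_pos S
    (LinearMap.ker G.mulVecLin ⊓ LinearMap.ker O.mulVecLin)
    (fun x hx hx0 => hG x hx0 (by simpa using hx.1))
  have hqid' : ∀ x, G *ᵥ x = 0 → O *ᵥ x = 0 → x - q x = 0 := fun x h1 h2 => by
    rw [hqid x ⟨by simpa using h1, by simpa using h2⟩, sub_self]
  obtain ⟨A, hA⟩ := exists_mulVec_mulVec_eq O (LinearMap.ker G.mulVecLin) (LinearMap.id - q)
    (fun x h1 h2 => hqid' x (by simpa using h1) h2)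
  obtain ⟨B, hB⟩ := exists_mulVec_mulVec_eq G (LinearMap.ker O.mulVecLin) (LinearMap.id - q)
    (fun x h1 h2 => hqid' x h2 (by simpa using h1))
  refine ⟨-(Bᵀ * Sᵀ * A), fun x hx hx0 => ?_⟩
  obtain ⟨y, hy, z, hz, rfl⟩ := Submodule.mem_sup.mp hx
  have hAy : A *ᵥ (O *ᵥ y) = y - q y := hA y hy
  have hBz : B *ᵥ (G *ᵥ z) = z - q z := hB z hz
  have hGy : G *ᵥ y = 0 := by simpa using hy
  have hOz : O *ᵥ z = 0 := by simpa using hz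
  have hGq : ∀ w, G *ᵥ q w = 0 := fun w => by simpa using (hqK w).1
  have hOq : ∀ w, O *ᵥ q w = 0 := fun w => by simpa using (hqK w).2
  rw [mulVec_add G, mulVec_add O, hGy, hOz, zero_add, add_zero, neg_mulVec, dotProduct_neg,
    dotProduct_transpose_mul_transpose_mul_mulVec, hAy, hBz, dotProduct_comm (S *ᵥ _)]
  obtain ⟨u, hu⟩ : ∃ u, u = y - q y := ⟨_, rfl⟩
  obtain ⟨v, hv⟩ : ∃ v, v = z - q z := ⟨_, rfl⟩
  have hsplit : (y + z) ⬝ᵥ (S *ᵥ (y + z)) + 2 * -(u ⬝ᵥ (S *ᵥ v)) =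
      u ⬝ᵥ (S *ᵥ u) + v ⬝ᵥ (S *ᵥ v) + (q y + q z) ⬝ᵥ (S *ᵥ (q y + q z)) := by
    have e1 : y + z = u + v + (q y + q z) := by rw [hu, hv]; abel
    have hk := Submodule.add_mem _ (hqK y) (hqK z)
    have o1 := hqo y _ hk
    have o2 := hqo z _ hk
    rw [← hu] at o1
    rw [← hv] at o2
    have o1' := o1
    have o2' := o2
    rw [hS.dotProduct_mulVec_comm] at o1' o2'
    have c := hS.dotProduct_mulVec_comm u v
    rw [e1]
    generalize q y + q z = k at *
    simp only [mulVec_add, dotProduct_add, add_dotProduct]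
    linarith
  rw [← hu, ← hv, hsplit]
  have nonneg_of : ∀ w, (w ≠ 0 → 0 < w ⬝ᵥ (S *ᵥ w)) → 0 ≤ w ⬝ᵥ (S *ᵥ w) := fun w hw => by
    by_cases h : w = 0
    · simp [h]
    · exact (hw h).le
  have pu : u ≠ 0 → 0 < u ⬝ᵥ (S *ᵥ u) := fun h =>
    hG u h (by rw [hu, mulVec_sub, hGy, hGq, sub_zero])
  have pv : v ≠ 0 → 0 < v ⬝ᵥ (S *ᵥ v) := fun h =>
    hO v h (by rw [hv, mulVec_sub, hOz, hOq, sub_zero])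
  have pk : q y + q z ≠ 0 → 0 < (q y + q z) ⬝ᵥ (S *ᵥ (q y + q z)) := fun h =>
    hG _ h (by rw [mulVec_add, hGq, hGq, add_zero])
  have nu := nonneg_of _ pu
  have nv := nonneg_of _ pv
  have nk := nonneg_of _ pk
  by_cases h1 : u = 0
  · by_cases h2 : v = 0
    · have h3 : q y + q z ≠ 0 := by
        rwa [← sub_eq_zero.mp (hu.symm.trans h1), ← sub_eq_zero.mp (hv.symm.trans h2)]
      linarith [pk h3]
    · linarith [pv h2]
  · linarith [pu h1]

end Matrix

/-- Projection/elimination lemma: there exists `Λ` with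
`Ψ + ΓᵀΛΩ + ΩᵀΛᵀΓ ≻ 0` iff `Ψ` is positive definite on the kernels of `Γ` and `Ω`. -/
theorem projection_lemma (n m p : ℕ)
    (Ψ : Matrix (Fin n) (Fin n) ℝ) (hΨ : Ψ.IsSymm)
    (Γ : Matrix (Fin m) (Fin n) ℝ) (Ω : Matrix (Fin p) (Fin n) ℝ)
    (hrank : Ω.rank = p) (hpn : p < n) :
    (∃ Λ : Matrix (Fin m) (Fin p) ℝ, (Ψ + Γᵀ * Λ * Ω + Ωᵀ * Λᵀ * Γ).PosDef) ↔
    ((∀ x : Fin n → ℝ, x ≠ 0 → Γ *ᵥ x = 0 → 0 < x ⬝ᵥ (Ψ *ᵥ x)) ∧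
     (∀ x : Fin n → ℝ, x ≠ 0 → Ω *ᵥ x = 0 → 0 < x ⬝ᵥ (Ψ *ᵥ x))) := by
  constructor
  · rintro ⟨Λ, hΛ⟩
    have hpos : ∀ x, x ≠ 0 → 0 < x ⬝ᵥ (Ψ *ᵥ x) + 2 * (Γ *ᵥ x ⬝ᵥ (Λ *ᵥ (Ω *ᵥ x))) :=
      fun x hx => by
        rw [← dotProduct_add_add_transpose_mulVec]
        simpa using (posDef_iff_dotProduct_mulVec.mp hΛ).2 hx
    exact ⟨fun x hx h => by simpa [h] using hpos x hx, fun x hx h => by simpa [h] using hpos x hx⟩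
  · rintro ⟨hΓ, hΩ⟩
    obtain ⟨L, hL⟩ := exists_pos_on_sup_ker hΨ Γ Ω hΓ hΩ
    obtain ⟨r, hr⟩ := LinearMap.exists_leftInverse_of_injective
      (LinearMap.ker Γ.mulVecLin ⊔ LinearMap.ker Ω.mulVecLin).subtype (Submodule.ker_subtype _)
    let T : (Fin n → ℝ) →ₗ[ℝ] (Fin n → ℝ) := LinearMap.id - Submodule.subtype _ ∘ₗ r
    have hT : ∀ x ∈ LinearMap.ker Γ.mulVecLin ⊔ LinearMap.ker Ω.mulVecLin, T x = 0 :=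
      fun x hx => by
        have h : r x = ⟨x, hx⟩ := LinearMap.congr_fun hr ⟨x, hx⟩
        simp [T, h]
    have hT' : ∀ x, T x = 0 → x ∈ LinearMap.ker Γ.mulVecLin ⊔ LinearMap.ker Ω.mulVecLin :=
      fun x hx => by
        have h : x = r x := sub_eq_zero.mp hx
        rw [h]
        exact (r x).2
    obtain ⟨C, hC⟩ := exists_mulVec_mulVec_eq Γ ⊤ T
      (fun x _ h => hT x (Submodule.mem_sup_left (by simpa using h)))
    obtain ⟨D, hD⟩ := exists_mulVec_mulVec_eq Ω ⊤ T
      (fun x _ h => hT x (Submodule.mem_sup_right (by simpa using h)))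
    obtain ⟨t, ht⟩ := exists_pos_add_mul_dotProduct_self
      (Ψ + Γᵀ * L * Ω + Ωᵀ * Lᵀ * Γ) (LinearMap.toMatrix' T) (fun x hx h => by
        rw [dotProduct_add_add_transpose_mulVec]
        exact hL x (hT' x (by simpa [LinearMap.toMatrix'_mulVec] using h)) hx)
    refine ⟨L + (t / 2) • (Cᵀ * D), posDef_iff_dotProduct_mulVec.mpr ⟨?_, fun {x} hx => ?_⟩⟩
    · rw [IsHermitian, conjTranspose_eq_transpose_of_trivial]
      simp only [transpose_add, transpose_mul, transpose_transpose, hΨ.eq, Matrix.mul_assoc]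
      abel
    · have h := ht x hx
      rw [dotProduct_add_add_transpose_mulVec, LinearMap.toMatrix'_mulVec] at h
      have hCD : Γ *ᵥ x ⬝ᵥ ((Cᵀ * D) *ᵥ (Ω *ᵥ x)) = T x ⬝ᵥ T x := by
        rw [← mulVec_mulVec, dotProduct_mulVec, vecMul_transpose, hC x trivial, hD x trivial]
      rw [star_trivial, dotProduct_add_add_transpose_mulVec, add_mulVec, smul_mulVec,
        dotProduct_add, dotProduct_smul, hCD, smul_eq_mul]
      linarith
end
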